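/- arXiv:1003.3997 — 2 statements merged into one kernel-verified Lean document; each statement's English description precedes it below -/
import Mathlib

section
/- Let L_0, L_1 ∈ ℂ[z_0, z_1, z_2] be two linearly independent homogeneous linear forms and set G = L_0·L_1 (a line pair). Then for every integer d ≥ 0 the image of the ℂ-linear map θ_G : S_d^3 → S_{d+1} defined by θ_G(F_0, F_1, F_2) = F_0·∂G/∂z_0 + F_1·∂G/∂z_1 + F_2·∂G/∂z_2 has ℂ-dimension C(d+3, 2) − 1. -/
open MvPolynomial

/-- The map `θ_G : (F₀,F₁,F₂) ↦ F₀·∂G/∂z₀ + F₁·∂G/∂z₁ + F₂·∂G/∂z₂`. -/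
noncomputable def thetaMap (G : MvPolynomial (Fin 3) ℂ) :
    (Fin 3 → MvPolynomial (Fin 3) ℂ) →ₗ[ℂ] MvPolynomial (Fin 3) ℂ :=
  ∑ i, (LinearMap.mulRight ℂ (pderiv i G)).comp (LinearMap.proj i)

/-- The space `S_d^3` of triples of homogeneous polynomials of degree `d` in `z₀,z₁,z₂`. -/
noncomputable def SdTriples (d : ℕ) :
    Submodule ℂ (Fin 3 → MvPolynomial (Fin 3) ℂ) :=
  Submodule.pi Set.univ fun _ => homogeneousSubmodule (Fin 3) ℂ d

theorem finrank_homog (n : ℕ) :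
    Module.finrank ℂ (homogeneousSubmodule (Fin 3) ℂ n) = (n + 2).choose 2 := by
  rw [homogeneousSubmodule_eq_finsupp_supported]
  have h := Module.finrank_eq_nat_card_basis
    (basisRestrictSupport (σ := Fin 3) ℂ {d : Fin 3 →₀ ℕ | d.degree = n})
  refine h.trans ?_
  have e : {d : Fin 3 →₀ ℕ | d.degree = n}
      = ((Finset.univ : Finset (Fin 3)).finsuppAntidiag n : Set (Fin 3 →₀ ℕ)) := by
    ext d
    simp [Finsupp.degree_eq_sum]
  rw [e, Nat.card_coe_set_eq, Set.ncard_coe_finset, Finset.card_finsuppAntidiag_nat_eq_choose]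
  simp only [Finset.card_univ, Fintype.card_fin]
  rw [show 3 + n - 1 = n + 2 by omega]
  exact Nat.choose_symm_add

theorem aeval_line (F : MvPolynomial (Fin 3) ℂ) (n : ℕ) (hF : F.IsHomogeneous n)
    (q : Fin 3 → ℂ) (k : Fin 3) :
    aeval (fun i => (C (q i) * X k : MvPolynomial (Fin 3) ℂ)) F = C (eval q F) * X k ^ n := by
  rw [aeval_def, eval₂_eq', eval_eq', map_sum, Finset.sum_mul]
  refine Finset.sum_congr rfl fun m hm => ?_
  have h1 : ∑ i, m i = n := by
    rw [← Finsupp.degree_eq_sum]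
    by_contra h
    exact (mem_support_iff.mp hm) (hF.coeff_eq_zero h)
  simp only [mul_pow, Finset.prod_mul_distrib, Finset.prod_pow_eq_pow_sum, h1, map_mul, map_prod,
    map_pow, algebraMap_eq]
  ring

theorem homComp_mul (A B : MvPolynomial (Fin 3) ℂ) (d : ℕ) (hB : B.IsHomogeneous 1) :
    homogeneousComponent (d + 1) (A * B) = homogeneousComponent d A * B := by
  let _ := MvPolynomial.gradedAlgebra (σ := Fin 3) (R := ℂ)
  have := DirectSum.coe_decompose_mul_add_of_right_mem (homogeneousSubmodule (Fin 3) ℂ)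
    (i := d) (a := A) hB
  have h1 := decomposition.decompose'_apply (A * B) (d+1)
  have h2 := decomposition.decompose'_apply A d
  rw [← h1, ← h2]
  exact this

theorem exists_coeffs (L : MvPolynomial (Fin 3) ℂ) (hL : L ∈ homogeneousSubmodule (Fin 3) ℂ 1) :
    ∃ a : Fin 3 → ℂ, L = ∑ i, C (a i) * X i := by
  rw [homogeneousSubmodule_one_eq_span_X, Submodule.mem_span_range_iff_exists_fun] at hL
  obtain ⟨a, ha⟩ := hL
  exact ⟨a, by simp [← ha, smul_eq_C_mul]⟩

theorem exists_minor (a b : Fin 3 → ℂ) (h : LinearIndependent ℂ ![a, b]) :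
    ∃ k, crossProduct a b k ≠ 0 := by
  have := crossProduct_ne_zero_iff_linearIndependent.mpr h
  exact Function.ne_iff.mp this

theorem mem_J (a b : Fin 3 → ℂ) (J : Ideal (MvPolynomial (Fin 3) ℂ))
    (hJ : ∀ i, C (a i) * (∑ i, C (b i) * X i) + C (b i) * (∑ i, C (a i) * X i) ∈ J)
    (k : Fin 3) (hk : crossProduct a b k ≠ 0) (i : Fin 3) :
    X i - C (crossProduct a b i / crossProduct a b k) * X k ∈ J := by
  have hun : ∀ x : MvPolynomial (Fin 3) ℂ, C (crossProduct a b k) * x ∈ J → x ∈ J := by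
    intro x hx
    have := J.mul_mem_left (C (crossProduct a b k)⁻¹) hx
    rwa [← mul_assoc, ← C_mul, inv_mul_cancel₀ hk, C_1, one_mul] at this
  have hm1 : ∀ i j, C (a i * b j - a j * b i) * (∑ i, C (b i) * X i) ∈ J := by
    intro i j
    have := J.sub_mem (J.mul_mem_left (C (b j)) (hJ i)) (J.mul_mem_left (C (b i)) (hJ j))
    convert this using 1
    simp only [map_sub, map_mul]; ring
  have hm0 : ∀ i j, C (a i * b j - a j * b i) * (∑ i, C (a i) * X i) ∈ J := by
    intro i j
    have := J.sub_mem (J.mul_mem_left (C (a i)) (hJ j)) (J.mul_mem_left (C (a j)) (hJ i))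
    convert this using 1
    simp only [map_sub, map_mul]; ring
  have hL1 : (∑ i, C (b i) * X i) ∈ J := by
    apply hun
    fin_cases k
    · simpa [cross_apply] using hm1 1 2
    · simpa [cross_apply] using hm1 2 0
    · simpa [cross_apply] using hm1 0 1
  have hL0 : (∑ i, C (a i) * X i) ∈ J := by
    apply hun
    fin_cases k
    · simpa [cross_apply] using hm0 1 2
    · simpa [cross_apply] using hm0 2 0
    · simpa [cross_apply] using hm0 0 1
  have hc : ∀ j, C (b j) * (∑ i, C (a i) * X i) - C (a j) * (∑ i, C (b i) * X i) ∈ J :=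
    fun j => J.sub_mem (J.mul_mem_left _ hL0) (J.mul_mem_left _ hL1)
  apply hun
  rw [mul_sub, ← mul_assoc, ← C_mul, mul_div_cancel₀ _ hk]
  have hc' := fun j => J.neg_mem (hc j)
  clear hm0 hm1 hL0 hL1 hJ hun hk
  have h0 := hc 0
  have h1 := hc 1
  have h2 := hc 2
  have g0 := hc' 0
  have g1 := hc' 1
  have g2 := hc' 2
  simp only [Fin.sum_univ_three] at h0 h1 h2 g0 g1 g2
  fin_cases k <;> fin_cases i <;> simp [cross_apply] <;>
  first
  | (convert h0 using 1; ring1)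
  | (convert h1 using 1; ring1)
  | (convert h2 using 1; ring1)
  | (convert g0 using 1; ring1)
  | (convert g1 using 1; ring1)
  | (convert g2 using 1; ring1)

theorem image_eq (a b : Fin 3 → ℂ) (G : MvPolynomial (Fin 3) ℂ)
    (hG : G = (∑ i, C (a i) * X i) * (∑ i, C (b i) * X i))
    (k : Fin 3) (hk : crossProduct a b k ≠ 0) (d : ℕ) :
    Submodule.map (thetaMap G) (SdTriples d) = homogeneousSubmodule (Fin 3) ℂ (d + 1) ⊓
      LinearMap.ker (aeval (fun i => crossProduct a b i / crossProduct a b k) :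
        MvPolynomial (Fin 3) ℂ →ₐ[ℂ] ℂ).toLinearMap := by
  have hD : ∀ i, pderiv i G =
      C (a i) * (∑ i, C (b i) * X i) + C (b i) * (∑ i, C (a i) * X i) := by
    intro i
    subst hG
    fin_cases i <;> simp [Fin.sum_univ_three, pderiv_X] <;> ring
  have hlin : ∀ c : Fin 3 → ℂ, (∑ i, C (c i) * X i : MvPolynomial (Fin 3) ℂ).IsHomogeneous 1 :=
    fun c => IsHomogeneous.sum _ _ _ fun i _ => isHomogeneous_C_mul_X _ _
  have hDh : ∀ i, (pderiv i G).IsHomogeneous 1 := by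
    intro i
    rw [hD]
    exact ((hlin b).C_mul _).add ((hlin a).C_mul _)
  have hth : ∀ F, thetaMap G F = ∑ i, F i * pderiv i G := by
    intro F; simp [thetaMap]
  ext F
  constructor
  · rintro ⟨c, hc, rfl⟩
    have hc' : ∀ i, (c i).IsHomogeneous d := fun i => hc i (Set.mem_univ i)
    rw [hth]
    refine ⟨IsHomogeneous.sum _ _ _ fun i _ => (hc' i).mul (hDh i), ?_⟩
    have ha : ∑ i, a i * (crossProduct a b i / crossProduct a b k) = 0 := by
      simp only [Fin.sum_univ_three, cross_apply]; simp; ring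
    have hb : ∑ i, b i * (crossProduct a b i / crossProduct a b k) = 0 := by
      simp only [Fin.sum_univ_three, cross_apply]; simp; ring
    simp only [hD]
    simp
    simp only [ha, hb]
    simp
  · rintro ⟨hF, h0⟩
    have hF' : F.IsHomogeneous (d + 1) := hF
    set q : Fin 3 → ℂ := fun i => crossProduct a b i / crossProduct a b k with hq
    have h0' : eval q F = 0 := by simpa [coe_aeval_eq_eval] using h0
    set J : Ideal (MvPolynomial (Fin 3) ℂ) := Ideal.span (Set.range fun i => pderiv i G) with hJ
    have hX := mem_J a b J (fun i => by rw [← hD]; exact Ideal.subset_span ⟨i, rfl⟩) k hk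
    have hFJ : F ∈ J := by
      rw [← Ideal.Quotient.eq_zero_iff_mem]
      have e : (Ideal.Quotient.mkₐ ℂ J) =
          (Ideal.Quotient.mkₐ ℂ J).comp (aeval fun i => (C (q i) * X k)) := by
        apply MvPolynomial.algHom_ext
        intro i
        simp only [AlgHom.comp_apply, aeval_X, Ideal.Quotient.mkₐ_eq_mk]
        exact Ideal.Quotient.eq.mpr (hX i)
      have := congrArg (fun f => f F) e
      simp only [AlgHom.comp_apply, aeval_line F _ hF', h0'] at this
      simpa using this
    rw [hJ] at hFJ
    obtain ⟨c, hc⟩ := (Ideal.mem_span_range_iff_exists_fun).mp hFJ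
    refine ⟨fun i => homogeneousComponent d (c i), fun i _ => homogeneousComponent_mem _ _, ?_⟩
    rw [hth, ← homogeneousComponent_eq_self hF', ← hc, map_sum]
    exact Finset.sum_congr rfl fun i _ => (homComp_mul _ _ _ (hDh i)).symm

/-- **Line-pair case of the rank trichotomy for `θ` (Section 3).**  If `G = L₀·L₁`
is a product of two linearly independent linear forms in `z₀,z₁,z₂`, then for every
`d ≥ 0` the image of `θ_G : S_d^3 → S_{d+1}` has dimension `C(d+3, 2) − 1`. -/
theorem thetaMap_rank_of_line_pair (L₀ L₁ G : MvPolynomial (Fin 3) ℂ)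
    (hL₀ : L₀ ∈ homogeneousSubmodule (Fin 3) ℂ 1)
    (hL₁ : L₁ ∈ homogeneousSubmodule (Fin 3) ℂ 1)
    (hindep : LinearIndependent ℂ ![L₀, L₁])
    (hG : G = L₀ * L₁) (d : ℕ) :
    Module.finrank ℂ (Submodule.map (thetaMap G) (SdTriples d)) = (d + 3).choose 2 - 1 := by
  obtain ⟨a, rfl⟩ := exists_coeffs L₀ hL₀
  obtain ⟨b, rfl⟩ := exists_coeffs L₁ hL₁
  have hab : LinearIndependent ℂ ![a, b] := by
    rw [LinearIndependent.pair_iff] at hindep ⊢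
    intro s t hst
    apply hindep s t
    have : ∀ i, s * a i + t * b i = 0 := fun i => by simpa using congrFun hst i
    simp only [smul_eq_C_mul, Finset.mul_sum, ← mul_assoc, ← C_mul]
    rw [← Finset.sum_add_distrib]
    refine Finset.sum_eq_zero fun i _ => ?_
    rw [← add_mul, ← C_add, this, C_0, zero_mul]
  obtain ⟨k, hk⟩ := exists_minor a b hab
  rw [image_eq a b G hG k hk d]
  set φ := (aeval (fun i => crossProduct a b i / crossProduct a b k) :
        MvPolynomial (Fin 3) ℂ →ₐ[ℂ] ℂ).toLinearMap with hφ
  set S := homogeneousSubmodule (Fin 3) ℂ (d + 1) with hS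
  have : FiniteDimensional ℂ S :=
    Module.Finite.iff_fg.mpr (homogeneousSubmodule_fg (Fin 3) ℂ (d + 1))
  have h1 := LinearMap.finrank_range_add_finrank_ker (φ.domRestrict S)
  have hsurj : LinearMap.range (φ.domRestrict S) = ⊤ := by
    rw [LinearMap.range_eq_top]
    intro c
    refine ⟨⟨C c * X k ^ (d + 1), isHomogeneous_C_mul_X_pow _ _ _⟩, ?_⟩
    simp [hφ, LinearMap.domRestrict_apply, div_self hk]
  rw [hsurj, finrank_top, Module.finrank_self, finrank_homog] at h1
  have h2 : Module.finrank ℂ (LinearMap.ker (φ.domRestrict S)) =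
      Module.finrank ℂ (S ⊓ LinearMap.ker φ : Submodule ℂ _) := by
    have : S ⊓ LinearMap.ker φ = (LinearMap.ker (φ.domRestrict S)).map S.subtype := by
      ext x
      simp [and_comm, LinearMap.domRestrict_apply]
    rw [this]
    exact (Submodule.finrank_map_subtype_eq _ _).symm
  rw [← h2]
  rw [show d + 1 + 2 = d + 3 by ring] at h1
  omega
end

section
/- Let G ∈ ℂ[z_0, z_1, z_2] be a homogeneous polynomial of degree 2 whose three partial derivatives ∂G/∂z_0, ∂G/∂z_1, ∂G/∂z_2 are linearly independent over ℂ (i.e., G defines a smooth conic). Then for every integer d ≥ 0 the ℂ-subspace {(F_0, F_1, F_2) ∈ S_d^3 : G divides F_0·∂G/∂z_0 + F_1·∂G/∂z_1 + F_2·∂G/∂z_2} of S_d^3 has ℂ-dimension d(3d+5)/2. -/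
open MvPolynomial

lemma aux_map {V W : Type*} [AddCommGroup V] [Module ℂ V] [AddCommGroup W] [Module ℂ W]
    (f : V →ₗ[ℂ] W) (hf : Function.Injective f) (p : Submodule ℂ V) :
    Module.finrank ℂ ↥(p.map f) = Module.finrank ℂ ↥p :=
  (Submodule.equivMapOfInjective f hf p).finrank_eq.symm

lemma aux_finrank (n : ℕ) :
    Module.finrank ℂ ↥(homogeneousSubmodule (Fin 3) ℂ n) = (n + 2).choose 2 := by
  rw [homogeneousSubmodule_eq_finsupp_supported]
  have b := basisRestrictSupport ℂ {d : Fin 3 →₀ ℕ | d.degree = n}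
  have h := Module.finrank_eq_nat_card_basis b
  refine h.trans ?_
  have hs : {d : Fin 3 →₀ ℕ | d.degree = n} =
      ((Finset.univ : Finset (Fin 3)).finsuppAntidiag n : Set (Fin 3 →₀ ℕ)) := by
    ext d
    simp [Finsupp.degree_eq_sum]
  rw [hs]
  simp only [SetLike.coe_sort_coe, Nat.card_eq_fintype_card, Fintype.card_coe]
  rw [Finset.card_finsuppAntidiag_nat_eq_choose]
  simp only [Finset.card_univ, Fintype.card_fin]
  rw [← Nat.choose_symm_of_eq_add (a := 2) (b := n)] <;> first | omega | skip
  congr 1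
  omega

instance aux_fin (n : ℕ) : Module.Finite ℂ ↥(homogeneousSubmodule (Fin 3) ℂ n) :=
  Module.Finite.iff_fg.mpr (homogeneousSubmodule_fg _ _ n)

lemma aux_theta (G : MvPolynomial (Fin 3) ℂ) (F) :
    thetaMap G F = ∑ i, F i * pderiv i G := by
  simp [thetaMap]

lemma aux_span (G : MvPolynomial (Fin 3) ℂ)
    (hG : G ∈ homogeneousSubmodule (Fin 3) ℂ 2)
    (hsmooth : LinearIndependent ℂ ![pderiv 0 G, pderiv 1 G, pderiv 2 G]) :
    Submodule.span ℂ (Set.range fun i => pderiv i G) = homogeneousSubmodule (Fin 3) ℂ 1 := by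
  have e : ![pderiv 0 G, pderiv 1 G, pderiv 2 G] = fun i => pderiv i G := by
    ext1 i; fin_cases i <;> rfl
  rw [e] at hsmooth
  apply Submodule.eq_of_le_of_finrank_eq
  · rw [Submodule.span_le]
    rintro _ ⟨i, rfl⟩
    exact IsHomogeneous.pderiv (n := 2) hG
  · rw [finrank_span_eq_card hsmooth, aux_finrank]; rfl

lemma aux_mem (d : ℕ) (F) : F ∈ SdTriples d ↔ ∀ i, (F i).IsHomogeneous d := by
  simp [SdTriples, Submodule.mem_pi]

lemma aux_range (G : MvPolynomial (Fin 3) ℂ)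
    (hG : G ∈ homogeneousSubmodule (Fin 3) ℂ 2)
    (hsmooth : LinearIndependent ℂ ![pderiv 0 G, pderiv 1 G, pderiv 2 G]) (d : ℕ) :
    (SdTriples d).map (thetaMap G) = homogeneousSubmodule (Fin 3) ℂ (d + 1) := by
  apply le_antisymm
  · rintro _ ⟨F, hF, rfl⟩
    rw [aux_theta]
    refine IsHomogeneous.sum _ _ _ fun i _ => ?_
    exact ((aux_mem d F).1 hF i).mul (IsHomogeneous.pderiv (n := 2) hG)
  · rw [← homogeneousSubmodule_one_pow, pow_succ, homogeneousSubmodule_one_pow, Submodule.mul_le]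
    intro p hp q hq
    rw [← aux_span G hG hsmooth, Submodule.mem_span_range_iff_exists_fun] at hq
    obtain ⟨c, rfl⟩ := hq
    refine ⟨fun i => c i • p, ?_, ?_⟩
    · exact (aux_mem d _).2 fun i => Submodule.smul_mem _ _ hp
    · rw [aux_theta, Finset.mul_sum]
      simp

lemma aux_W (G : MvPolynomial (Fin 3) ℂ)
    (hG : G ∈ homogeneousSubmodule (Fin 3) ℂ 2) (h0 : G ≠ 0) (d : ℕ) :
    Module.finrank ℂ ↥(homogeneousSubmodule (Fin 3) ℂ (d + 1) ⊓
      (Ideal.span {G}).restrictScalars ℂ) = (d + 1).choose 2 := by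
  have key : ∀ p : MvPolynomial (Fin 3) ℂ, G * p ∈ homogeneousSubmodule (Fin 3) ℂ (d + 1) →
      p ≠ 0 → ∃ e, d = e + 1 ∧ p.IsHomogeneous e := by
    intro p hp hp0
    obtain ⟨i, hi⟩ : ∃ i, homogeneousComponent i p ≠ 0 := by
      by_contra! h
      exact hp0 (by rw [← sum_homogeneousComponent p]; simp [h])
    have hc : ∀ i, homogeneousComponent (2 + i) (G * p) = G * homogeneousComponent i p := by
      intro i
      letI := gradedAlgebra (σ := Fin 3) (R := ℂ)
      have h := DirectSum.coe_decompose_mul_add_of_left_mem (homogeneousSubmodule (Fin 3) ℂ)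
        (j := i) (b := p) hG
      have h1 := decomposition.decompose'_apply (G * p) (2 + i)
      have h2 := decomposition.decompose'_apply p i
      rw [← h1, ← h2]
      exact h
    have hd : ∀ i, homogeneousComponent i p ≠ 0 → 2 + i = d + 1 := by
      intro i hi
      by_contra hne
      have := hc i
      rw [homogeneousComponent_of_mem hp, if_neg (by omega)] at this
      exact mul_ne_zero h0 hi this.symm
    refine ⟨i, by have := hd i hi; omega, ?_⟩
    have : p = homogeneousComponent i p := by
      conv_lhs => rw [← sum_homogeneousComponent p]
      have := hd i hi
      apply Finset.sum_eq_single i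
      · intro j _ hj
        by_contra h
        have := hd j h
        omega
      · intro h
        apply homogeneousComponent_eq_zero
        simpa using h
    rw [this]
    exact homogeneousComponent_isHomogeneous i p
  rcases d with _ | e
  · have : homogeneousSubmodule (Fin 3) ℂ (0 + 1) ⊓ (Ideal.span {G}).restrictScalars ℂ = ⊥ := by
      rw [eq_bot_iff]
      rintro x ⟨hx, hx'⟩
      obtain ⟨p, rfl⟩ := Ideal.mem_span_singleton.1 hx'
      by_cases hp : p = 0
      · simp [hp]
      · obtain ⟨e, he, _⟩ := key p hx hp
        omega
    rw [this]; simp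
  · have : homogeneousSubmodule (Fin 3) ℂ (e + 1 + 1) ⊓ (Ideal.span {G}).restrictScalars ℂ =
        (homogeneousSubmodule (Fin 3) ℂ e).map (LinearMap.mulLeft ℂ G) := by
      ext x
      constructor
      · rintro ⟨hx, hx'⟩
        obtain ⟨p, rfl⟩ := Ideal.mem_span_singleton.1 hx'
        refine ⟨p, ?_, rfl⟩
        by_cases hp : p = 0
        · rw [hp]; exact Submodule.zero_mem _
        · obtain ⟨e', he, h⟩ := key p hx hp
          obtain rfl : e = e' := by omega
          exact h
      · rintro ⟨p, hp, rfl⟩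
        refine ⟨?_, Ideal.mem_span_singleton.2 ⟨p, rfl⟩⟩
        have := IsHomogeneous.mul (show G.IsHomogeneous 2 from hG) hp
        rw [add_comm] at this
        exact this
    rw [this, aux_map _ (mul_right_injective₀ h0), aux_finrank]

lemma aux_finrank_triples (d : ℕ) :
    Module.Finite ℂ ↥(SdTriples d) ∧
    Module.finrank ℂ ↥(SdTriples d) = 3 * (d + 2).choose 2 := by
  let e : (Fin 3 → ↥(homogeneousSubmodule (Fin 3) ℂ d)) ≃ₗ[ℂ] ↥(SdTriples d) :=
    { toFun := fun f => ⟨fun i => f i, (aux_mem d _).2 fun i => (f i).2⟩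
      invFun := fun F i => ⟨F.1 i, (aux_mem d _).1 F.2 i⟩
      map_add' := fun _ _ => rfl
      map_smul' := fun _ _ => rfl
      left_inv := fun _ => rfl
      right_inv := fun _ => rfl }
  refine ⟨Module.Finite.equiv e, ?_⟩
  rw [← e.finrank_eq, Module.finrank_pi_fintype]
  simp [aux_finrank]

/-- **Fiber dimension of the bundle `M̃` of Section 3 over a smooth conic.**
If `G` is a homogeneous quadric in `z₀,z₁,z₂` whose partial derivatives are linearly
independent (a smooth conic), then for every `d ≥ 0` the subspace
`{(F₀,F₁,F₂) ∈ S_d^3 : G ∣ F₀·∂G/∂z₀ + F₁·∂G/∂z₁ + F₂·∂G/∂z₂}`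
of vector fields leaving the conic `{G = 0}` invariant has dimension `d(3d+5)/2`. -/
theorem dim_vector_fields_leaving_smooth_conic_invariant (G : MvPolynomial (Fin 3) ℂ)
    (hG : G ∈ homogeneousSubmodule (Fin 3) ℂ 2)
    (hsmooth : LinearIndependent ℂ ![pderiv 0 G, pderiv 1 G, pderiv 2 G]) (d : ℕ) :
    Module.finrank ℂ
        ↥(SdTriples d ⊓
          Submodule.comap (thetaMap G) ((Ideal.span {G}).restrictScalars ℂ))
      = d * (3 * d + 5) / 2 := by
  have h0 : G ≠ 0 := by
    rintro rfl
    exact hsmooth.ne_zero 0 (by simp)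
  obtain ⟨hfin, hrk⟩ := aux_finrank_triples d
  have hrange := aux_range G hG hsmooth d
  have hW := aux_W G hG h0 d
  set I : Submodule ℂ (MvPolynomial (Fin 3) ℂ) := (Ideal.span {G}).restrictScalars ℂ with hI
  have r1 := LinearMap.finrank_range_add_finrank_ker (I.mkQ.comp ((thetaMap G).domRestrict (SdTriples d)))
  have r2 := LinearMap.finrank_range_add_finrank_ker
    (I.mkQ.domRestrict (homogeneousSubmodule (Fin 3) ℂ (d + 1)))
  have e1 : LinearMap.range (I.mkQ.comp ((thetaMap G).domRestrict (SdTriples d))) =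
      LinearMap.range (I.mkQ.domRestrict (homogeneousSubmodule (Fin 3) ℂ (d + 1))) := by
    rw [LinearMap.range_comp, LinearMap.range_domRestrict, LinearMap.range_domRestrict, hrange]
  have e2 : Module.finrank ℂ ↥(LinearMap.ker (I.mkQ.comp ((thetaMap G).domRestrict (SdTriples d))))
      = Module.finrank ℂ ↥(SdTriples d ⊓ I.comap (thetaMap G)) := by
    have : LinearMap.ker (I.mkQ.comp ((thetaMap G).domRestrict (SdTriples d))) =
        (I.comap (thetaMap G)).comap (SdTriples d).subtype := by
      ext x; simp
    rw [this, ← Submodule.map_comap_subtype]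
    exact (aux_map _ (Submodule.subtype_injective _) _).symm
  have e3 : Module.finrank ℂ ↥(LinearMap.ker
        (I.mkQ.domRestrict (homogeneousSubmodule (Fin 3) ℂ (d + 1))))
      = Module.finrank ℂ ↥(homogeneousSubmodule (Fin 3) ℂ (d + 1) ⊓ I) := by
    have : LinearMap.ker (I.mkQ.domRestrict (homogeneousSubmodule (Fin 3) ℂ (d + 1))) =
        I.comap (homogeneousSubmodule (Fin 3) ℂ (d + 1)).subtype := by
      ext x; simp
    rw [this, ← Submodule.map_comap_subtype]
    exact (aux_map _ (Submodule.subtype_injective _) _).symm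
  rw [e1, e2, hrk] at r1
  rw [e3, hW, aux_finrank] at r2
  have c1 : (d + 1 + 2).choose 2 = (d + 2).choose 2 + (d + 2) := by
    rw [Nat.choose_succ_succ' (d + 2) 1, Nat.choose_one_right]; norm_num; omega
  have c2 : (d + 2).choose 2 = (d + 1).choose 2 + (d + 1) := by
    rw [Nat.choose_succ_succ' (d + 1) 1, Nat.choose_one_right]; norm_num; omega
  have c3 : 2 * (d + 1).choose 2 = d * d + d := by
    rw [Nat.choose_two_right, Nat.mul_div_cancel' (Nat.even_mul_pred_self _).two_dvd]
    simp; ring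
  have : d * (3 * d + 5) = 3 * (d * d) + 5 * d := by ring
  rw [this]
  omega
end
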